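/- Let X be a compact metric space, F : X → Set X a set-valued map with nonempty compact values that is upper semicontinuous, and let M ⊆ X be nonempty and compact with F(M) ⊆ M. Then there exists a nonempty compact set M' ⊆ M which is a minimal F-invariant set, i.e. F(M') = M' and no proper nonempty compact subset of M' is F-invariant. -/

import Mathlib

open Metric Set Filter Topology

/-- The extension of a set-valued map to subsets: `F(A) = ⋃_{x ∈ A} F(x)`. -/
def setImage {X : Type*} (F : X → Set X) (A : Set X) : Set X := ⋃ x ∈ A, F x

/-- A nonempty compact set `M` is a minimal `F`-invariant set if `F(M) = M` and no
proper nonempty compact subset of `M` is `F`-invariant. -/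
def IsMinimalInvariant {X : Type*} [MetricSpace X] (F : X → Set X) (M : Set X) : Prop :=
  M.Nonempty ∧ IsCompact M ∧ setImage F M = M ∧
    ∀ M' : Set X, M' ⊂ M → M'.Nonempty → IsCompact M' → setImage F M' ≠ M'

theorem setImage_mono {X : Type*} (F : X → Set X) {A B : Set X} (h : A ⊆ B) :
    setImage F A ⊆ setImage F B :=
  biUnion_subset_biUnion_left h

/-- The image of a compact set under a set-valued map with closed graph is closed. -/
theorem isClosed_setImage {X : Type*} [TopologicalSpace X] [CompactSpace X] [T2Space X]
    {F : X → Set X} (hF : IsClosed {p : X × X | p.2 ∈ F p.1}) {A : Set X} (hA : IsClosed A) :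
    IsClosed (setImage F A) := by
  have h : setImage F A = Prod.snd '' ({p : X × X | p.2 ∈ F p.1} ∩ Prod.fst ⁻¹' A) := by
    ext y
    simp [setImage, and_comm]
  rw [h]
  exact ((hF.inter (hA.preimage continuous_fst)).isCompact.image continuous_snd).isClosed

/-- Every nonempty closed set `M` with `F(M) ⊆ M` in a compact space contains a minimal one. -/
theorem exists_minimal_isClosed_setImage_subset {X : Type*} [TopologicalSpace X] [CompactSpace X]
    (F : X → Set X) {M : Set X} (hMne : M.Nonempty) (hMc : IsClosed M)
    (hsub : setImage F M ⊆ M) :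
    ∃ N ⊆ M, Minimal (fun A : Set X => A.Nonempty ∧ IsClosed A ∧ setImage F A ⊆ A) N := by
  refine zorn_superset_nonempty {A : Set X | A.Nonempty ∧ IsClosed A ∧ setImage F A ⊆ A}
    (fun c hc hchain hcne => ?_) M ⟨hMne, hMc, hsub⟩
  have := hcne.to_subtype
  have hdir : DirectedOn (· ⊇ ·) c := fun A hA B hB =>
    (hchain.total hA hB).elim (fun h => ⟨A, hA, subset_rfl, h⟩) fun h => ⟨B, hB, h, subset_rfl⟩
  refine ⟨⋂₀ c, ⟨?_, isClosed_sInter fun A hA => (hc hA).2.1, ?_⟩,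
    fun A hA => sInter_subset_of_mem hA⟩
  · exact IsCompact.nonempty_sInter_of_directed_nonempty_isCompact_isClosed
      hdir (fun A hA => (hc hA).1)
      (fun A hA => (hc hA).2.1.isCompact) (fun A hA => (hc hA).2.1)
  · exact subset_sInter fun A hA =>
      (setImage_mono F (sInter_subset_of_mem hA)).trans (hc hA).2.2

/-- Every nonempty compact set `M` with `F(M) ⊆ M` contains a minimal
`F`-invariant set. -/
theorem exists_minimal_invariant {X : Type*} [MetricSpace X] [CompactSpace X]
    (F : X → Set X)
    (hne : ∀ x, (F x).Nonempty)
    (hcpt : ∀ x, IsCompact (F x))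
    (husc : ∀ (x y : ℕ → X) (a b : X), Tendsto x atTop (𝓝 a) →
      (∀ n, y n ∈ F (x n)) → Tendsto y atTop (𝓝 b) → b ∈ F a)
    (M : Set X) (hMne : M.Nonempty) (hMc : IsCompact M)
    (hsub : setImage F M ⊆ M) :
    ∃ M' : Set X, M' ⊆ M ∧ IsMinimalInvariant F M' := by
  have hgraph : IsClosed {p : X × X | p.2 ∈ F p.1} := by
    refine IsSeqClosed.isClosed fun u p hu hp => ?_
    exact husc (fun n => (u n).1) (fun n => (u n).2) p.1 p.2
      ((continuous_fst.tendsto p).comp hp) hu ((continuous_snd.tendsto p).comp hp)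
  obtain ⟨N, hNM, ⟨hNne, hNc, hNsub⟩, hmin⟩ :=
    exists_minimal_isClosed_setImage_subset F hMne hMc.isClosed hsub
  refine ⟨N, hNM, hNne, hNc.isCompact, hNsub.antisymm (hmin ⟨?_, ?_, ?_⟩ hNsub), ?_⟩
  · obtain ⟨x, hx⟩ := hNne
    obtain ⟨y, hy⟩ := hne x
    exact ⟨y, mem_biUnion hx hy⟩
  · exact isClosed_setImage hgraph hNc
  · exact setImage_mono F hNsub
  · intro A hA hAne hAc hAinv
    exact hA.2 (hmin ⟨hAne, hAc.isClosed, hAinv.subset⟩ hA.1)
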